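/- arXiv:2406.00642 — 8 statements merged into one kernel-verified Lean document; each statement's English description precedes it below -/
import Mathlib

section
/- Let p be a prime and let N and M be natural numbers. Suppose that p divides the binomial coefficient C(N, j) for every integer j with 1 ≤ j ≤ M. Then for every natural number e with p^e ≤ M, the power p^{e+1} divides N. -/
/-- If a prime `p` divides `C(N, j)` for every `1 ≤ j ≤ M`, then `p^(e+1) ∣ N`
whenever `p^e ≤ M`. -/
theorem stmt_0 (p : ℕ) (hp : p.Prime) (N M : ℕ)
    (h : ∀ j : ℕ, 1 ≤ j → j ≤ M → p ∣ N.choose j) :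
    ∀ e : ℕ, p ^ e ≤ M → p ^ (e + 1) ∣ N := by
  have : Fact p.Prime := ⟨hp⟩
  have step (e : ℕ) (he : p ^ e ≤ M) (hdvd : p ^ e ∣ N) : p ^ (e + 1) ∣ N := by
    obtain ⟨q, rfl⟩ := hdvd
    have hq : (p ^ e * q).choose (p ^ e) ≡ q [MOD p] := by
      simpa using Choose.choose_pow_mul_pow_mul_modEq_choose_nat (p := p) (k := e) (a := q) (b := 1)
    rw [pow_succ]
    exact mul_dvd_mul_left _ ((hq.dvd_iff dvd_rfl).mp (h _ (Nat.pow_pos hp.pos) he))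
  intro e he
  induction e with
  | zero => exact step 0 he (by simp)
  | succ e ih => exact step (e + 1) he (ih ((Nat.pow_le_pow_right hp.pos e.le_succ).trans he))
end

section
/- Let G be a finite group with the property that for every finite-dimensional irreducible real representation W of G on which G acts nontrivially, the ℝ-algebra of G-equivariant linear endomorphisms of W has ℝ-dimension different from 1. Then every finite-dimensional real representation R of G whose subspace of G-invariant vectors is zero admits a G-invariant complex structure, i.e. an ℝ-linear endomorphism J of R with J ∘ J = −id which commutes with the action of every element of G. -/
universe u

/-- The `k`-submodule of `G`-equivariant linear endomorphisms of a representation `ρ`. -/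
def EquivariantEnd {k : Type*} [CommSemiring k] {G : Type*} [Monoid G]
    {V : Type*} [AddCommMonoid V] [Module k V] (ρ : Representation k G V) :
    Submodule k (V →ₗ[k] V) where
  carrier := {f | ∀ (g : G) (v : V), f (ρ g v) = ρ g (f v)}
  add_mem' := by
    intro f₁ f₂ h₁ h₂ g v
    simp [h₁ g v, h₂ g v]
  zero_mem' := by
    intro g v
    simp
  smul_mem' := by
    intro c f hf g v
    simp [hf g v]

/-- A representation is irreducible if it is nonzero and has no proper nonzero
invariant subspace. -/
def IsIrreducibleRep {k : Type*} [CommSemiring k] {G : Type*} [Monoid G]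
    {V : Type*} [AddCommMonoid V] [Module k V] (ρ : Representation k G V) : Prop :=
  Nontrivial V ∧
    ∀ p : Submodule k V, (∀ (g : G), ∀ v ∈ p, ρ g v ∈ p) → p = ⊥ ∨ p = ⊤

open Polynomial

section Schur

variable {k : Type*} [Field k] {G : Type*} [Group G] {V : Type*} [AddCommGroup V] [Module k V]
  {ρ : Representation k G V}

/-- Schur's lemma: an equivariant endomorphism of an irreducible representation is injective
or zero. -/
theorem IsIrreducibleRep.ker_eq_bot_or_eq_zero (hρ : IsIrreducibleRep ρ) {f : V →ₗ[k] V}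
    (hf : f ∈ EquivariantEnd ρ) : LinearMap.ker f = ⊥ ∨ f = 0 := by
  refine (hρ.2 (LinearMap.ker f) fun g v hv => ?_).imp_right LinearMap.ker_eq_top.mp
  rw [LinearMap.mem_ker] at hv ⊢
  rw [hf g v, hv, map_zero]

theorem IsIrreducibleRep.eq_zero_or_eq_zero_of_mul_eq_zero (hρ : IsIrreducibleRep ρ)
    {f h : V →ₗ[k] V} (hf : f ∈ EquivariantEnd ρ) (hfh : f * h = 0) : f = 0 ∨ h = 0 := by
  rcases hρ.ker_eq_bot_or_eq_zero hf with hker | h0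
  · right
    ext v
    exact LinearMap.ker_eq_bot.mp hker (by simpa using LinearMap.congr_fun hfh v)
  · exact Or.inl h0

theorem one_mem_equivariantEnd : (1 : V →ₗ[k] V) ∈ EquivariantEnd ρ := fun _ _ => rfl

theorem mul_mem_equivariantEnd {f h : V →ₗ[k] V} (hf : f ∈ EquivariantEnd ρ)
    (hh : h ∈ EquivariantEnd ρ) : f * h ∈ EquivariantEnd ρ := fun g v => by
  rw [Module.End.mul_apply, Module.End.mul_apply, hh g v, hf g (h v)]

theorem pow_mem_equivariantEnd {f : V →ₗ[k] V} (hf : f ∈ EquivariantEnd ρ) (n : ℕ) :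
    f ^ n ∈ EquivariantEnd ρ := by
  induction n with
  | zero => exact one_mem_equivariantEnd
  | succ n ih => rw [pow_succ]; exact mul_mem_equivariantEnd ih hf

theorem aeval_mem_equivariantEnd {f : Module.End k V} (hf : f ∈ EquivariantEnd ρ) (p : k[X]) :
    aeval f p ∈ EquivariantEnd ρ := by
  rw [aeval_eq_sum_range]
  exact Submodule.sum_mem _ fun i _ => Submodule.smul_mem _ _ (pow_mem_equivariantEnd hf i)

/-- The minimal polynomial of an equivariant endomorphism of an irreducible representation is
irreducible. -/
theorem IsIrreducibleRep.irreducible_minpoly [FiniteDimensional k V] (hρ : IsIrreducibleRep ρ)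
    {f : Module.End k V} (hf : f ∈ EquivariantEnd ρ) : Irreducible (minpoly k f) := by
  have := hρ.1
  refine Prime.irreducible ⟨minpoly.ne_zero (Algebra.IsIntegral.isIntegral f),
    minpoly.not_isUnit k f, fun a b hab => ?_⟩
  have h0 : aeval f a * aeval f b = 0 := by
    rw [← map_mul]
    exact (minpoly.dvd_iff).mp hab
  exact (hρ.eq_zero_or_eq_zero_of_mul_eq_zero (aeval_mem_equivariantEnd hf a) h0).imp
    (minpoly.dvd k f) (minpoly.dvd k f)

/-- If the equivariant endomorphisms of a nonzero representation are not one-dimensional, one of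
them is not scalar. -/
theorem exists_mem_equivariantEnd_forall_ne_smul_one [Nontrivial V]
    (h : Module.finrank k (EquivariantEnd ρ) ≠ 1) :
    ∃ f ∈ EquivariantEnd ρ, ∀ c : k, f ≠ c • (1 : V →ₗ[k] V) := by
  by_contra! hc
  refine h (finrank_eq_one_iff'.mpr ⟨⟨1, one_mem_equivariantEnd⟩, ?_, fun f => ?_⟩)
  · exact fun h0 => one_ne_zero (congrArg Subtype.val h0)
  · obtain ⟨c, hc⟩ := hc f f.2
    exact ⟨c, Subtype.ext hc.symm⟩

end Schur

/-- A real irreducible representation with a non-scalar equivariant endomorphism has an invariant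
complex structure. -/
theorem IsIrreducibleRep.exists_complexStructure {G : Type*} [Group G] {V : Type*}
    [AddCommGroup V] [Module ℝ V] [FiniteDimensional ℝ V] {ρ : Representation ℝ G V}
    (hρ : IsIrreducibleRep ρ) (h : Module.finrank ℝ (EquivariantEnd ρ) ≠ 1) :
    ∃ J ∈ EquivariantEnd ρ, ∀ v, J (J v) = -v := by
  have := hρ.1
  obtain ⟨f, hf, hns⟩ := exists_mem_equivariantEnd_forall_ne_smul_one h
  have hdeg := (hρ.irreducible_minpoly hf).natDegree_le_two
  have hmonic : (minpoly ℝ f).Monic := minpoly.monic (Algebra.IsIntegral.isIntegral f)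
  have hne : (minpoly ℝ f).natDegree ≠ 1 := fun h1 => by
    obtain ⟨c, hc⟩ := minpoly.natDegree_eq_one_iff.mp h1
    exact hns c (by rw [← hc, Algebra.algebraMap_eq_smul_one])
  have hpos : 0 < (minpoly ℝ f).natDegree :=
    minpoly.natDegree_pos (Algebra.IsIntegral.isIntegral f)
  have h2 : (minpoly ℝ f).natDegree = 2 := by omega
  obtain ⟨b, c, hbc⟩ : ∃ b c : ℝ, f * f + b • f + c • (1 : V →ₗ[ℝ] V) = 0 := by
    refine ⟨(minpoly ℝ f).coeff 1, (minpoly ℝ f).coeff 0, ?_⟩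
    have h0 := minpoly.aeval ℝ f
    have hlead : (minpoly ℝ f).coeff 2 = 1 := h2 ▸ hmonic.coeff_natDegree
    rw [aeval_eq_sum_range, h2] at h0
    simp only [Finset.sum_range_succ, Finset.range_zero, Finset.sum_empty, hlead, pow_zero,
      pow_one, pow_two, one_smul, zero_add] at h0
    rw [← h0]
    abel
  set s : V →ₗ[ℝ] V := f + (b / 2) • 1 with hs
  have hsmem : s ∈ EquivariantEnd ρ :=
    Submodule.add_mem _ hf (Submodule.smul_mem _ _ one_mem_equivariantEnd)
  have hsq : s * s = (b ^ 2 / 4 - c) • (1 : V →ₗ[ℝ] V) := by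
    rw [← sub_eq_zero, ← hbc, hs]
    simp only [add_mul, mul_add, smul_mul_assoc, mul_smul_comm, one_mul, mul_one]
    module
  have hneg : b ^ 2 / 4 - c < 0 := by
    by_contra! hd
    have hprod : (s - √(b ^ 2 / 4 - c) • 1) * (s + √(b ^ 2 / 4 - c) • (1 : V →ₗ[ℝ] V)) = 0 := by
      simp only [sub_mul, mul_add, smul_mul_assoc, mul_smul_comm, one_mul, mul_one, hsq,
        smul_sub, smul_smul, Real.mul_self_sqrt hd]
      abel
    rcases hρ.eq_zero_or_eq_zero_of_mul_eq_zero (Submodule.sub_mem _ hsmem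
      (Submodule.smul_mem _ _ one_mem_equivariantEnd)) hprod with h0 | h0
    · apply hns (√(b ^ 2 / 4 - c) - b / 2)
      rw [← sub_eq_zero, ← h0, hs]
      module
    · apply hns (-√(b ^ 2 / 4 - c) - b / 2)
      rw [← sub_eq_zero, ← h0, hs]
      module
  set r := √(-(b ^ 2 / 4 - c))
  have hr0 : r ≠ 0 := (Real.sqrt_pos.mpr (by linarith)).ne'
  have hrr : r * r = -(b ^ 2 / 4 - c) := Real.mul_self_sqrt (by linarith)
  refine ⟨r⁻¹ • s, Submodule.smul_mem _ _ hsmem, fun v => ?_⟩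
  have hv : s (s v) = (b ^ 2 / 4 - c) • v := LinearMap.congr_fun hsq v
  have hscal : r⁻¹ * (r⁻¹ * (b ^ 2 / 4 - c)) = -1 := by
    rw [← neg_neg (b ^ 2 / 4 - c), ← hrr]
    field_simp
  simp only [LinearMap.smul_apply, map_smul, hv, smul_smul, hscal, neg_one_smul]

/-- Invariant complex structures on two complementary subrepresentations glue. -/
theorem exists_complexStructure_of_isCompl {k : Type*} [CommRing k] {G : Type*} [Group G]
    {V : Type*} [AddCommGroup V] [Module k V] {ρ : Representation k G V}
    {p q : Subrepresentation ρ} (hpq : IsCompl p.toSubmodule q.toSubmodule)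
    (hp : ∃ J ∈ EquivariantEnd p.toRepresentation, ∀ v, J (J v) = -v)
    (hq : ∃ J ∈ EquivariantEnd q.toRepresentation, ∀ v, J (J v) = -v) :
    ∃ J ∈ EquivariantEnd ρ, ∀ v, J (J v) = -v := by
  obtain ⟨J₁, hJ₁, hsq₁⟩ := hp
  obtain ⟨J₂, hJ₂, hsq₂⟩ := hq
  set J := LinearMap.ofIsCompl hpq (p.toSubmodule.subtype ∘ₗ J₁) (q.toSubmodule.subtype ∘ₗ J₂)
  have hl (v : p.toSubmodule) : J v = J₁ v := LinearMap.ofIsCompl_apply_left hpq v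
  have hr (v : q.toSubmodule) : J v = J₂ v := LinearMap.ofIsCompl_apply_right hpq v
  have hdec (v : V) : ∃ (x : p.toSubmodule) (y : q.toSubmodule), v = x + y := by
    obtain ⟨x, hx, y, hy, rfl⟩ := Submodule.mem_sup.mp
      (hpq.sup_eq_top ▸ Submodule.mem_top : v ∈ p.toSubmodule ⊔ q.toSubmodule)
    exact ⟨⟨x, hx⟩, ⟨y, hy⟩, rfl⟩
  refine ⟨J, fun g v => ?_, fun v => ?_⟩
  · obtain ⟨x, y, rfl⟩ := hdec v
    have hx : J (ρ g x) = ρ g (J₁ x) :=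
      (hl (p.toRepresentation g x)).trans (congrArg Subtype.val (hJ₁ g x))
    have hy : J (ρ g y) = ρ g (J₂ y) :=
      (hr (q.toRepresentation g y)).trans (congrArg Subtype.val (hJ₂ g y))
    simp only [map_add, hx, hy, hl, hr]
  · obtain ⟨x, y, rfl⟩ := hdec v
    simp only [map_add, hl, hr, hsq₁, hsq₂, Submodule.coe_neg]
    abel

/-- A nonzero reducible representation of a finite group in characteristic zero splits as a sum
of two proper subrepresentations. -/
theorem exists_isCompl_of_not_isIrreducibleRep {k : Type*} [Field k] [CharZero k] {G : Type*}
    [Group G] [Finite G] {V : Type*} [AddCommGroup V] [Module k V] [Nontrivial V]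
    {ρ : Representation k G V} (hρ : ¬ IsIrreducibleRep ρ) :
    ∃ p q : Subrepresentation ρ, IsCompl p.toSubmodule q.toSubmodule ∧
      p.toSubmodule ≠ ⊤ ∧ q.toSubmodule ≠ ⊤ := by
  have : ∃ p : Submodule k V, (∀ g, ∀ v ∈ p, ρ g v ∈ p) ∧ p ≠ ⊥ ∧ p ≠ ⊤ := by
    by_contra! hc
    exact hρ ⟨inferInstance, fun p hp => or_iff_not_imp_left.mpr (hc p hp)⟩
  obtain ⟨p, hp, hbot, htop⟩ := this
  have : NeZero (Nat.card G : k) := ⟨Nat.cast_ne_zero.mpr Nat.card_pos.ne'⟩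
  obtain ⟨q, hq⟩ := exists_isCompl (⟨p, fun g v hv => hp g v hv⟩ : Subrepresentation ρ)
  have hc : IsCompl p q.toSubmodule :=
    .of_eq (congrArg Subrepresentation.toSubmodule hq.inf_eq_bot)
      (congrArg Subrepresentation.toSubmodule hq.sup_eq_top)
  exact ⟨⟨p, fun g v hv => hp g v hv⟩, q, hc, htop, fun h => hbot (by simpa [h] using hc.inf_eq_bot)⟩

/-- If every nontrivial finite-dimensional irreducible real representation of the finite
group `G` has equivariant endomorphism algebra of `ℝ`-dimension different from `1`, then every
finite-dimensional real representation of `G` with no nonzero invariant vectors admits a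
`G`-invariant complex structure. -/
theorem stmt_1 {G : Type u} [Group G] [Finite G]
    (hG : ∀ (W : Type u) [AddCommGroup W] [Module ℝ W] [FiniteDimensional ℝ W]
      (ρ : Representation ℝ G W), IsIrreducibleRep ρ → (∃ (g : G) (w : W), ρ g w ≠ w) →
      Module.finrank ℝ (EquivariantEnd ρ) ≠ 1)
    (R : Type u) [AddCommGroup R] [Module ℝ R] [FiniteDimensional ℝ R]
    (ρ : Representation ℝ G R)
    (hR : ∀ v : R, (∀ g : G, ρ g v = v) → v = 0) :
    ∃ J : R →ₗ[ℝ] R, (∀ v : R, J (J v) = -v) ∧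
      ∀ (g : G) (v : R), J (ρ g v) = ρ g (J v) := by
  suffices h : ∀ (n : ℕ) (V : Type u) [AddCommGroup V] [Module ℝ V] [FiniteDimensional ℝ V]
      (σ : Representation ℝ G V), (∀ v, (∀ g, σ g v = v) → v = 0) → Module.finrank ℝ V = n →
      ∃ J ∈ EquivariantEnd σ, ∀ v, J (J v) = -v by
    obtain ⟨J, hJ, hsq⟩ := h _ R ρ hR rfl
    exact ⟨J, hsq, hJ⟩
  intro n
  induction n using Nat.strong_induction_on with
  | _ n ih =>
    intro V _ _ _ σ hσ hn
    rcases subsingleton_or_nontrivial V with hV | hV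
    · exact ⟨0, Submodule.zero_mem _, fun v => Subsingleton.elim _ _⟩
    by_cases hirr : IsIrreducibleRep σ
    · refine hirr.exists_complexStructure (hG V σ hirr ?_)
      by_contra! htriv
      obtain ⟨v, hv⟩ := exists_ne (0 : V)
      exact hv (hσ v fun g => htriv g v)
    · obtain ⟨p, q, hpq, hp, hq⟩ := exists_isCompl_of_not_isIrreducibleRep hirr
      have hsub (p : Subrepresentation σ) (hp : p.toSubmodule ≠ ⊤) :
          ∃ J ∈ EquivariantEnd p.toRepresentation, ∀ v, J (J v) = -v :=
        ih _ (hn ▸ Submodule.finrank_lt hp) p.toSubmodule p.toRepresentation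
          (fun v hv => Subtype.ext (hσ v fun g => congrArg Subtype.val (hv g))) rfl
      exact exists_complexStructure_of_isCompl hpq (hsub p hp) (hsub q hq)
end

section
/- Let G be a finite group with the property that for every finite-dimensional irreducible real representation W of G on which G acts nontrivially, the ℝ-algebra of G-equivariant linear endomorphisms of W has ℝ-dimension different from 1. Let V be a finite-dimensional complex representation of G whose subspace of G-invariant vectors is zero. Then every G-equivariant bijective ℝ-linear map φ : V → V (φ is only required to be ℝ-linear, not ℂ-linear) has strictly positive determinant when regarded as an ℝ-linear automorphism of the underlying real vector space of V. -/
universe u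

open Polynomial in
/-- A monic real polynomial without real roots is positive at every point. -/
theorem Polynomial.Monic.eval_pos_of_forall_not_isRoot {p : ℝ[X]} (hp : p.Monic)
    (hroot : ∀ x, ¬ p.IsRoot x) (a : ℝ) : 0 < p.eval a := by
  by_contra! ha
  obtain hdeg | hdeg := Nat.eq_zero_or_pos p.natDegree
  · rw [hp.natDegree_eq_zero.1 hdeg, eval_one] at ha
    linarith
  · have htop := p.tendsto_atTop_of_leadingCoeff_nonneg (natDegree_pos_iff_degree_pos.1 hdeg)
      (hp.leadingCoeff ▸ zero_le_one)
    obtain ⟨b, hb⟩ := (htop.eventually_ge_atTop 0).exists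
    obtain ⟨c, hc⟩ := mem_range_of_exists_le_of_exists_ge p.continuous ⟨a, ha⟩ ⟨b, hb⟩
    exact hroot c hc

open Polynomial in
/-- A monic real polynomial whose real roots all have even multiplicity is nonnegative. -/
theorem Polynomial.Monic.eval_nonneg_of_even_rootMultiplicity {p : ℝ[X]} (hp : p.Monic)
    (heven : ∀ x, Even (p.rootMultiplicity x)) (a : ℝ) : 0 ≤ p.eval a := by
  classical
  obtain ⟨q, hpq, -, hq⟩ := exists_prod_multiset_X_sub_C_mul p
  have hprod : (p.roots.map fun x ↦ X - C x).prod.Monic := monic_multiset_prod_of_monic _ _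
    fun x _ ↦ monic_X_sub_C x
  have hqm : q.Monic := hprod.of_mul_monic_left (by rwa [hpq])
  have hqroot : ∀ x, ¬ q.IsRoot x := fun x hx ↦ by
    have := (mem_roots hqm.ne_zero).2 hx
    simp [hq] at this
  rw [← hpq, eval_mul, Finset.prod_multiset_map_count, eval_prod]
  refine mul_nonneg (Finset.prod_nonneg fun x _ ↦ ?_)
    (hqm.eval_pos_of_forall_not_isRoot hqroot a).le
  rw [eval_pow, count_roots]
  exact (heven x).pow_nonneg _

/-- Every endomorphism of an odd-dimensional real vector space has an eigenvalue. -/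
theorem Module.End.exists_hasEigenvalue_of_odd_finrank {W : Type*} [AddCommGroup W] [Module ℝ W]
    [FiniteDimensional ℝ W] (hodd : Odd (Module.finrank ℝ W)) (f : Module.End ℝ W) :
    ∃ c, f.HasEigenvalue c := by
  by_contra! hf
  have hneg (g : Module.End ℝ W) (hg : ∀ c, ¬ g.HasEigenvalue c) : LinearMap.det g < 0 := by
    have := g.charpoly_monic.eval_pos_of_forall_not_isRoot
      (fun c hc ↦ hg c ((Module.End.hasEigenvalue_iff_isRoot_charpoly g c).2 hc)) 0
    rw [LinearMap.det_eq_sign_charpoly_coeff, hodd.neg_one_pow,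
      Polynomial.coeff_zero_eq_eval_zero]
    linarith
  have h₁ := hneg f hf
  have h₂ := hneg (-f) fun c hc ↦ by
    obtain ⟨v, hv⟩ := hc.exists_hasEigenvector
    refine hf (-c) (Module.End.hasEigenvalue_of_hasEigenvector (x := v)
      ⟨Module.End.mem_eigenspace_iff.2 ?_, hv.2⟩)
    rw [neg_smul, ← hv.apply_eq_smul, LinearMap.neg_apply, neg_neg]
  rw [← neg_one_smul ℝ f, LinearMap.det_smul, hodd.neg_one_pow] at h₂
  linarith

/-- An endomorphism of a finite-dimensional real vector space whose generalized eigenspaces all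
have even dimension, on an even-dimensional space, has nonnegative determinant. -/
theorem LinearMap.det_nonneg_of_even_finrank_maxGenEigenspace {W : Type*} [AddCommGroup W]
    [Module ℝ W] [FiniteDimensional ℝ W] (hW : Even (Module.finrank ℝ W)) (f : Module.End ℝ W)
    (hf : ∀ c, Even (Module.finrank ℝ (f.maxGenEigenspace c))) : 0 ≤ LinearMap.det f := by
  rw [LinearMap.det_eq_sign_charpoly_coeff, hW.neg_one_pow, one_mul,
    Polynomial.coeff_zero_eq_eval_zero]
  refine f.charpoly_monic.eval_nonneg_of_even_rootMultiplicity (fun c ↦ ?_) 0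
  rw [← LinearMap.finrank_maxGenEigenspace_eq]
  exact hf c

/-- An odd-dimensional irreducible real representation has only scalar equivariant
endomorphisms. -/
theorem IsIrreducibleRep.finrank_equivariantEnd_eq_one {G W : Type*} [Monoid G] [AddCommGroup W]
    [Module ℝ W] [FiniteDimensional ℝ W] {ρ : Representation ℝ G W} (hρ : IsIrreducibleRep ρ)
    (hodd : Odd (Module.finrank ℝ W)) : Module.finrank ℝ (EquivariantEnd ρ) = 1 := by
  have := hρ.1
  refine finrank_eq_one (⟨LinearMap.id, fun _ _ ↦ rfl⟩ : EquivariantEnd ρ) (fun h ↦ ?_) ?_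
  · obtain ⟨w, hw⟩ := exists_ne (0 : W)
    exact hw (LinearMap.congr_fun (congrArg Subtype.val h) w)
  · rintro ⟨f, hf⟩
    obtain ⟨c, hc⟩ := Module.End.exists_hasEigenvalue_of_odd_finrank hodd f
    refine ⟨c, Subtype.ext (LinearMap.ext fun w ↦ ?_)⟩
    have htop := (hρ.2 (Module.End.eigenspace f c) fun g v hv ↦ by
      rw [Module.End.mem_eigenspace_iff] at hv ⊢
      rw [hf, hv, map_smul]).resolve_left hc
    have hw : w ∈ Module.End.eigenspace f c := htop ▸ Submodule.mem_top
    exact (Module.End.mem_eigenspace_iff.1 hw).symm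

/-- **Maschke's theorem**: an invariant subspace of a real representation of a finite group has an
invariant complement. -/
theorem Subrepresentation.exists_isCompl_toSubmodule {G W : Type*} [Group G] [Finite G]
    [AddCommGroup W] [Module ℝ W] {ρ : Representation ℝ G W} (p : Subrepresentation ρ) :
    ∃ q : Subrepresentation ρ, IsCompl p.toSubmodule q.toSubmodule := by
  have : NeZero (Nat.card G : ℝ) := ⟨Nat.cast_ne_zero.2 Nat.card_pos.ne'⟩
  obtain ⟨q, hq⟩ := exists_isCompl p
  exact ⟨q, disjoint_iff.2 (congrArg toSubmodule hq.inf_eq_bot),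
    codisjoint_iff.2 (congrArg toSubmodule hq.sup_eq_top)⟩

/-- If no nontrivial irreducible real representation of the finite group `G` has endomorphism
algebra `ℝ`, then every real representation of `G` without invariants is even-dimensional. -/
theorem Representation.even_finrank_of_forall_invariant_eq_zero {G : Type*} [Group G] [Finite G]
    (hG : ∀ (W : Type u) [AddCommGroup W] [Module ℝ W] [FiniteDimensional ℝ W]
      (ρ : Representation ℝ G W), IsIrreducibleRep ρ → (∃ (g : G) (w : W), ρ g w ≠ w) →
      Module.finrank ℝ (EquivariantEnd ρ) ≠ 1)
    (W : Type u) [AddCommGroup W] [Module ℝ W] [FiniteDimensional ℝ W]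
    (ρ : Representation ℝ G W) (hinv : ∀ w : W, (∀ g : G, ρ g w = w) → w = 0) :
    Even (Module.finrank ℝ W) := by
  induction hn : Module.finrank ℝ W using Nat.strong_induction_on generalizing W with
  | _ n ih =>
  subst hn
  by_contra hodd
  rw [Nat.not_even_iff_odd] at hodd
  have hnt : Nontrivial W := Module.nontrivial_of_finrank_pos (R := ℝ) hodd.pos
  by_cases hirr : IsIrreducibleRep ρ
  · refine hG W ρ hirr ?_ (hirr.finrank_equivariantEnd_eq_one hodd)
    by_contra! htriv
    obtain ⟨w, hw⟩ := exists_ne (0 : W)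
    exact hw (hinv w fun g ↦ htriv g w)
  · obtain ⟨p, hp, hbot, htop⟩ : ∃ p : Submodule ℝ W, (∀ g : G, ∀ v ∈ p, ρ g v ∈ p) ∧
        p ≠ ⊥ ∧ p ≠ ⊤ := by
      by_contra! h
      exact hirr ⟨hnt, fun p hp ↦ or_iff_not_imp_left.2 (h p hp)⟩
    let p' : Subrepresentation ρ := ⟨p, fun g v ↦ hp g v⟩
    obtain ⟨q, hq⟩ := p'.exists_isCompl_toSubmodule
    have hsum := Submodule.finrank_add_eq_of_isCompl hq
    have heven (s : Subrepresentation ρ)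
        (hs : Module.finrank ℝ s.toSubmodule < Module.finrank ℝ W) :
        Even (Module.finrank ℝ s.toSubmodule) :=
      ih _ hs s.toSubmodule s.toRepresentation
        (fun w hw ↦ Subtype.ext (hinv w fun g ↦ congrArg Subtype.val (hw g))) rfl
    have hpos : 0 < Module.finrank ℝ p'.toSubmodule :=
      Nat.pos_of_ne_zero fun h ↦ hbot (Submodule.finrank_eq_zero.1 h)
    have hlt : Module.finrank ℝ p'.toSubmodule < Module.finrank ℝ W :=
      Submodule.finrank_lt htop
    refine Nat.not_even_iff_odd.2 hodd ?_
    rw [← hsum]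
    exact (heven p' hlt).add (heven q (by omega))

/-- If every nontrivial finite-dimensional irreducible real representation of the finite
group `G` has equivariant endomorphism algebra of `ℝ`-dimension different from `1`, and `V` is
a finite-dimensional complex representation of `G` with no nonzero invariant vectors, then any
`G`-equivariant bijective `ℝ`-linear map `φ : V → V` has positive determinant as an `ℝ`-linear
endomorphism of the underlying real vector space. -/
theorem stmt_2 {G : Type u} [Group G] [Finite G]
    (hG : ∀ (W : Type u) [AddCommGroup W] [Module ℝ W] [FiniteDimensional ℝ W]
      (ρ : Representation ℝ G W), IsIrreducibleRep ρ → (∃ (g : G) (w : W), ρ g w ≠ w) →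
      Module.finrank ℝ (EquivariantEnd ρ) ≠ 1)
    (V : Type u) [AddCommGroup V] [Module ℂ V] [FiniteDimensional ℂ V]
    (ρ : Representation ℂ G V)
    (hV : ∀ v : V, (∀ g : G, ρ g v = v) → v = 0)
    (φ : V →ₗ[ℝ] V) (hbij : Function.Bijective φ)
    (hequiv : ∀ (g : G) (v : V), φ (ρ g v) = ρ g (φ v)) :
    0 < LinearMap.det φ := by
  have : FiniteDimensional ℝ V := FiniteDimensional.complexToReal V
  let σ : Representation ℝ G V :=
    { toFun g := (ρ g).restrictScalars ℝ
      map_one' := by ext; simp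
      map_mul' _ _ := by ext; simp }
  refine lt_of_le_of_ne (LinearMap.det_nonneg_of_even_finrank_maxGenEigenspace
    (Representation.even_finrank_of_forall_invariant_eq_zero hG V σ hV) φ fun c ↦ ?_)
    (LinearEquiv.isUnit_det' (LinearEquiv.ofBijective φ hbij)).ne_zero.symm
  have hcomm (g : G) : Commute φ (σ g) := LinearMap.ext (hequiv g)
  let E : Subrepresentation σ :=
    ⟨Module.End.maxGenEigenspace φ c, fun g _ hv ↦
      Module.End.mapsTo_maxGenEigenspace_of_comm (hcomm g) c hv⟩
  exact Representation.even_finrank_of_forall_invariant_eq_zero hG E.toSubmodule E.toRepresentation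
    fun v hv ↦ Subtype.ext (hV v fun g ↦ congrArg Subtype.val (hv g))
end

section
/- Let G be a finite group of odd order and let W be a finite-dimensional irreducible real representation of G on which G acts nontrivially. Then the ℝ-algebra of G-equivariant linear endomorphisms of W has ℝ-dimension strictly greater than 1; equivalently, W is not of real type. -/
open Matrix in
/-- A real matrix representation of a finite group preserves a positive definite form. -/
lemma exists_posDef_invariant {G n : Type*} [Group G] [Fintype G] [Fintype n] [DecidableEq n]
    (R : G →* Matrix n n ℝ) :
    ∃ M : Matrix n n ℝ, M.PosDef ∧ ∀ g, (R g)ᵀ * M * R g = M := by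
  classical
  refine ⟨∑ g, (R g)ᵀ * R g, ?_, fun h => ?_⟩
  · rw [← Finset.add_sum_erase _ _ (Finset.mem_univ 1)]
    refine PosDef.add_posSemidef (by simpa using PosDef.one) (posSemidef_sum _ fun g _ => ?_)
    simpa using posSemidef_conjTranspose_mul_self (R g)
  · rw [Finset.mul_sum, Finset.sum_mul]
    refine Fintype.sum_equiv (Equiv.mulRight h) _ _ fun g => ?_
    simp [Matrix.mul_assoc]

/-- If only scalar matrices commute with a matrix representation, then averaging a matrix by
conjugation gives the scalar with the same trace. -/
lemma card_mul_sum_conj_eq_trace_smul {G n : Type*} [Group G] [Fintype G] [Fintype n]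
    [DecidableEq n] (R : G →* Matrix n n ℝ)
    (hR : ∀ A : Matrix n n ℝ, (∀ g, R g * A = A * R g) → ∃ c : ℝ, A = c • 1)
    (A : Matrix n n ℝ) :
    (Fintype.card n : ℝ) • ∑ g, R g * A * R g⁻¹ = ((Fintype.card G : ℝ) * A.trace) • 1 := by
  obtain ⟨c, hc⟩ := hR (∑ g, R g * A * R g⁻¹) fun h => by
    rw [Finset.mul_sum, Finset.sum_mul]
    refine Fintype.sum_equiv (Equiv.mulLeft h) _ _ fun g => ?_
    simp only [Equiv.coe_mulLeft, map_mul, mul_inv_rev, Matrix.mul_assoc]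
    rw [← map_mul R h⁻¹ h]
    simp
  have htr := congrArg Matrix.trace hc
  have hg : ∀ g, (R g * A * R g⁻¹).trace = A.trace := fun g => by
    rw [Matrix.trace_mul_comm, ← Matrix.mul_assoc, ← map_mul]
    simp
  simp only [Matrix.trace_sum, hg, Finset.sum_const, Finset.card_univ, Matrix.trace_smul,
    Matrix.trace_one, nsmul_eq_mul, smul_eq_mul] at htr
  rw [hc, smul_smul, htr, mul_comm]

open Matrix in
/-- The Frobenius–Schur sum of a real matrix representation with scalar commutant. -/
lemma sum_trace_sq_eq_card {G n : Type*} [Group G] [Fintype G] [Fintype n] [DecidableEq n]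
    [Nonempty n] (R : G →* Matrix n n ℝ)
    (hR : ∀ A : Matrix n n ℝ, (∀ g, R g * A = A * R g) → ∃ c : ℝ, A = c • 1) :
    ∑ g, (R (g ^ 2)).trace = Fintype.card G := by
  obtain ⟨M, hM, hinv⟩ := exists_posDef_invariant R
  have hdet : IsUnit M.det := (isUnit_iff_isUnit_det M).1 hM.isUnit
  have hsymm : Mᵀ = M := by simpa using hM.isHermitian.eq
  have hconj : ∀ g, M * R g⁻¹ = (R g)ᵀ * M := fun g => by
    conv_lhs => rw [← hinv g]
    rw [Matrix.mul_assoc, ← map_mul]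
    simp
  have key : ∀ X : Matrix n n ℝ, (Fintype.card n : ℝ) • ∑ g, R g * X * (R g)ᵀ =
      ((Fintype.card G : ℝ) * (X * M).trace) • M⁻¹ := fun X => by
    have h := congrArg (· * M⁻¹) (card_mul_sum_conj_eq_trace_smul R hR (X * M))
    simp only [smul_mul, Matrix.one_mul, Finset.sum_mul] at h
    rw [← h]
    congr 1
    refine Finset.sum_congr rfl fun g _ => ?_
    rw [Matrix.mul_assoc (R g) (X * M), Matrix.mul_assoc X, hconj]
    simp only [Matrix.mul_assoc, mul_nonsing_inv _ hdet, Matrix.mul_one]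
  have entry : ∀ i j, (Fintype.card n : ℝ) * ∑ g, R g i j * R g j i =
      Fintype.card G * (M i j * M⁻¹ i j) := fun i j => by
    have h := congrFun (congrFun (key (single j i 1)) i) j
    have h1 : ∀ g, (R g * single j i (1 : ℝ) * (R g)ᵀ) i j = R g i j * R g j i := fun g => by
      simp [Matrix.mul_apply, Matrix.single_apply, ite_and]
    have h2 : (single j i (1 : ℝ) * M).trace = M i j := by
      simp [Matrix.trace, Matrix.mul_apply, Matrix.single_apply, ite_and]
    simp only [Matrix.smul_apply, Matrix.sum_apply, h1, h2, smul_eq_mul] at h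
    rw [h, mul_assoc]
  have hn : (Fintype.card n : ℝ) ≠ 0 := by simp
  apply mul_left_cancel₀ hn
  have hMM : ∑ i, ∑ j, M i j * M⁻¹ i j = (Fintype.card n : ℝ) := by
    rw [← trace_one (R := ℝ), ← nonsing_inv_mul _ hdet]
    simp only [Matrix.trace, diag_apply, Matrix.mul_apply]
    rw [Finset.sum_comm]
    refine Finset.sum_congr rfl fun i _ => Finset.sum_congr rfl fun j _ => ?_
    have h1 : M j i = M i j := congrFun (congrFun hsymm i) j
    have h2 : M⁻¹ j i = M⁻¹ i j := by
      rw [← transpose_apply M⁻¹, transpose_nonsing_inv, hsymm]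
    rw [h1, h2, mul_comm]
  calc (Fintype.card n : ℝ) * ∑ g, (R (g ^ 2)).trace
      = ∑ i, ∑ j, (Fintype.card n : ℝ) * ∑ g, R g i j * R g j i := by
        simp only [pow_two, map_mul, Matrix.trace, diag_apply, Matrix.mul_apply,
          ← Finset.mul_sum]
        rw [Finset.sum_comm]
        congr 1
        exact Finset.sum_congr rfl fun i _ => Finset.sum_comm
    _ = Fintype.card n * Fintype.card G := by
        simp only [entry, ← Finset.mul_sum]
        rw [hMM, mul_comm]

/-- The Frobenius–Schur sum of a real representation whose equivariant endomorphisms are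
scalars. -/
lemma sum_linearMap_trace_sq_eq_card {G W : Type*} [Group G] [Fintype G] [AddCommGroup W]
    [Module ℝ W] [FiniteDimensional ℝ W] [Nontrivial W] (ρ : Representation ℝ G W)
    (hρ : ∀ f ∈ EquivariantEnd ρ, ∃ c : ℝ, f = c • LinearMap.id) :
    ∑ g, LinearMap.trace ℝ W (ρ (g ^ 2)) = Fintype.card G := by
  obtain ⟨n, ⟨b⟩⟩ : ∃ n, Nonempty (Module.Basis (Fin n) ℝ W) := ⟨_, ⟨Module.finBasis ℝ W⟩⟩
  have : Nonempty (Fin n) := b.index_nonempty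
  have hFS := sum_trace_sq_eq_card
    ((LinearMap.toMatrixAlgEquiv b).toMulEquiv.toMonoidHom.comp ρ) fun A hA => by
      obtain ⟨f, rfl⟩ := (LinearMap.toMatrixAlgEquiv b).surjective A
      obtain ⟨c, rfl⟩ := hρ f fun g w => by
        have h : LinearMap.toMatrixAlgEquiv b (ρ g) * LinearMap.toMatrixAlgEquiv b f =
            LinearMap.toMatrixAlgEquiv b f * LinearMap.toMatrixAlgEquiv b (ρ g) := hA g
        rw [← map_mul, ← map_mul] at h
        exact (LinearMap.congr_fun ((LinearMap.toMatrixAlgEquiv b).injective h) w).symm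
      exact ⟨c, by rw [map_smul, LinearMap.toMatrixAlgEquiv_id]⟩
  rw [← hFS]
  exact Finset.sum_congr rfl fun g _ => LinearMap.trace_eq_matrix_trace ℝ b _

/-- If `G` is a finite group of odd order and `W` is a finite-dimensional irreducible real
representation of `G` on which `G` acts nontrivially, then the algebra of `G`-equivariant
endomorphisms of `W` has `ℝ`-dimension strictly greater than `1` (i.e. `W` is not of real
type). -/
theorem stmt_3 {G : Type*} [Group G] [Finite G] (hodd : Odd (Nat.card G))
    (W : Type*) [AddCommGroup W] [Module ℝ W] [FiniteDimensional ℝ W]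
    (ρ : Representation ℝ G W) (hirr : IsIrreducibleRep ρ)
    (hnontriv : ∃ (g : G) (w : W), ρ g w ≠ w) :
    1 < Module.finrank ℝ (EquivariantEnd ρ) := by
  classical
  have := Fintype.ofFinite G
  obtain ⟨hW, hsub⟩ := hirr
  by_contra hlt
  obtain ⟨v, hv⟩ := finrank_le_one_iff.1 (not_lt.1 hlt)
  have hscalar : ∀ f ∈ EquivariantEnd ρ, ∃ c : ℝ, f = c • LinearMap.id := fun f hf => by
    obtain ⟨a, ha⟩ := hv ⟨LinearMap.id, fun _ _ => rfl⟩
    obtain ⟨b, hb⟩ := hv ⟨f, hf⟩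
    have ha' : a • (v : W →ₗ[ℝ] W) = LinearMap.id := congrArg Subtype.val ha
    have hb' : b • (v : W →ₗ[ℝ] W) = f := congrArg Subtype.val hb
    have ha0 : a ≠ 0 := by
      rintro rfl
      obtain ⟨w, hw⟩ := exists_ne (0 : W)
      exact hw (by simpa using (LinearMap.congr_fun ha' w).symm)
    refine ⟨b * a⁻¹, ?_⟩
    rw [← ha', ← hb', smul_smul, inv_mul_cancel_right₀ ha0]
  have hsum : ∑ g, ρ g = 0 := by
    have hfix : ∀ w, (∑ g, ρ g) w ∈ ρ.invariants := fun w h => by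
      simp only [LinearMap.sum_apply, map_sum]
      refine Fintype.sum_equiv (Equiv.mulLeft h) _ _ fun g => ?_
      simp
    rcases hsub ρ.invariants (fun g w hw => by rwa [hw g]) with h | h
    · ext w
      simpa [h] using hfix w
    · obtain ⟨g, w, hw⟩ := hnontriv
      have hmem : w ∈ ρ.invariants := h ▸ Submodule.mem_top
      exact absurd (hmem g) hw
  have hcop : (Nat.card G).Coprime 2 := hodd.coprime_two_right
  have hFS := sum_linearMap_trace_sq_eq_card ρ hscalar
  rw [Fintype.sum_equiv (powCoprime hcop) (fun g => LinearMap.trace ℝ W (ρ (g ^ 2)))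
    (fun g => LinearMap.trace ℝ W (ρ g)) fun _ => rfl, ← map_sum, hsum, map_zero] at hFS
  exact Fintype.card_ne_zero (α := G) (by exact_mod_cast hFS.symm)
end

section
/- Let G be a finite group of odd order. Then every finite-dimensional real representation R of G whose subspace of G-invariant vectors is zero admits a G-invariant complex structure, i.e. an ℝ-linear endomorphism J of R with J ∘ J = −id which commutes with the action of every element of G. -/
open Matrix in
/-- The linear map `B ↦ Mᵀ Bᵀ M` on square matrices has trace `tr (M²)`. -/
theorem Matrix.trace_transpose_congruence {n : Type*} [Fintype n] [DecidableEq n]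
    (M : Matrix n n ℝ) (T : Matrix n n ℝ →ₗ[ℝ] Matrix n n ℝ)
    (hT : ∀ B, T B = Mᵀ * Bᵀ * M) :
    LinearMap.trace ℝ _ T = (M * M).trace := by
  rw [LinearMap.trace_eq_matrix_trace ℝ (Matrix.stdBasis ℝ n n)]
  have key : ∀ i j : n, (LinearMap.toMatrix (Matrix.stdBasis ℝ n n) (Matrix.stdBasis ℝ n n) T)
      (i, j) (i, j) = M j i * M i j := by
    intro i j
    rw [LinearMap.toMatrix_apply, Matrix.stdBasis_eq_single, hT]
    change (Mᵀ * (single i j (1 : ℝ))ᵀ * M) i j = _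
    simp [Matrix.mul_apply, Matrix.single, ite_and]
  simp_rw [Matrix.trace, Matrix.diag, Fintype.sum_prod_type, key, Matrix.mul_apply]
  exact Finset.sum_congr rfl fun i _ ↦ Finset.sum_congr rfl fun j _ ↦ mul_comm _ _

/-- An element of a real algebra without zero divisors which is integral but not a scalar yields
a square root of `-1`. -/
theorem exists_mul_self_eq_neg_one_of_isIntegral {D : Type*} [Ring D] [IsDomain D] [Algebra ℝ D]
    {x : D} (hx : IsIntegral ℝ x) (hx' : x ∉ (algebraMap ℝ D).range) :
    ∃ J : D, J * J = -1 := by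
  have hdeg := (minpoly.irreducible hx).degree_le_two
  have hnat : (minpoly ℝ x).natDegree = 2 := by
    have h1 := minpoly.natDegree_eq_one_iff (A := ℝ) (x := x)
    have h2 := minpoly.natDegree_pos hx
    have h3 := (Polynomial.natDegree_le_iff_degree_le (n := 2)).2 hdeg
    have h4 := mt h1.1 hx'
    omega
  have hlead : (minpoly ℝ x).coeff 2 = 1 := by
    rw [← hnat]; exact minpoly.monic hx
  have haeval := minpoly.aeval ℝ x
  rw [Polynomial.eq_quadratic_of_degree_le_two hdeg, hlead] at haeval
  generalize (minpoly ℝ x).coeff 1 = b at haeval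
  generalize (minpoly ℝ x).coeff 0 = c at haeval
  have hquad : x * x + b • x + c • (1 : D) = 0 := by
    simpa [Algebra.smul_def, pow_two] using haeval
  have hsq : (x + (b / 2) • (1 : D)) * (x + (b / 2) • (1 : D)) = (b ^ 2 / 4 - c) • (1 : D) := by
    have hxx : x * x = -(b • x) - c • (1 : D) := by
      rw [← sub_eq_zero, ← hquad]; abel
    simp only [mul_add, add_mul, mul_smul_comm, smul_mul_assoc, mul_one, one_mul, hxx]
    module
  have hy : ∀ t : ℝ, x + (b / 2) • (1 : D) ≠ t • (1 : D) := fun t ht ↦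
    hx' ⟨t - b / 2, by
      rw [Algebra.algebraMap_eq_smul_one, sub_smul, ← ht, add_sub_cancel_right]⟩
  generalize x + (b / 2) • (1 : D) = y at hsq hy
  generalize b ^ 2 / 4 - c = d at hsq
  have hd : d < 0 := by
    by_contra! hd
    have hprod : (y - √d • (1 : D)) * (y - (-√d) • (1 : D)) = 0 := by
      simp only [mul_sub, sub_mul, mul_smul_comm, smul_mul_assoc, mul_one, one_mul, hsq]
      nth_rw 1 [← Real.mul_self_sqrt hd]
      module
    rcases mul_eq_zero.1 hprod with h | h
    · exact hy _ (sub_eq_zero.1 h)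
    · exact hy _ (sub_eq_zero.1 h)
  refine ⟨(√(-d))⁻¹ • y, ?_⟩
  rw [smul_mul_smul_comm, hsq, smul_smul, ← mul_inv, Real.mul_self_sqrt (by linarith), inv_neg,
    neg_mul, inv_mul_cancel₀ hd.ne, neg_one_smul]

open Matrix in
/-- A nonzero real matrix representation of a finite group of odd order whose matrices sum to zero
commutes with some non-scalar matrix. -/
theorem Matrix.exists_commute_not_scalar_of_odd_card {G n : Type*} [Group G] [Fintype G]
    [Fintype n] [DecidableEq n] [Nonempty n] (hodd : Odd (Nat.card G))
    (M : G →* Matrix n n ℝ) (hM : ∑ g, M g = 0) :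
    ∃ A : Matrix n n ℝ, (∀ g, Commute A (M g)) ∧ ∀ c : ℝ, A ≠ c • (1 : Matrix n n ℝ) := by
  by_contra! hscalar
  let h : Matrix n n ℝ := ∑ g, (M g)ᵀ * M g
  have hinj (g : G) : Function.Injective (M g).mulVec := by
    refine Function.LeftInverse.injective (g := (M g⁻¹).mulVec) fun v ↦ ?_
    rw [Matrix.mulVec_mulVec, ← map_mul, inv_mul_cancel, map_one, Matrix.one_mulVec]
  have hpos : h.PosDef := by
    refine Matrix.posDef_sum Finset.univ_nonempty fun g _ ↦ ?_
    simpa using Matrix.PosDef.conjTranspose_mul_self (M g) (hinj g)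
  have hinv (B : Matrix n n ℝ) (g : G) :
      (M g)ᵀ * (∑ k, (M k)ᵀ * B * M k) * M g = ∑ k, (M k)ᵀ * B * M k := by
    rw [Finset.mul_sum, Finset.sum_mul]
    refine Fintype.sum_equiv (Equiv.mulRight g) _ _ fun k ↦ ?_
    simp [Matrix.mul_assoc]
  have hhinv (g : G) : (M g)ᵀ * h * M g = h := by simpa using hinv 1 g
  have hhT : hᵀ = h := by simp [h, Matrix.transpose_sum]
  have hdet : IsUnit h.det := (Matrix.isUnit_iff_isUnit_det _).1 hpos.isUnit
  have hcomm (B : Matrix n n ℝ) (hB : ∀ g, (M g)ᵀ * B * M g = B) (g : G) :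
      B * M g = (M g⁻¹)ᵀ * B := by
    nth_rw 1 [← hB g⁻¹]
    rw [Matrix.mul_assoc, ← map_mul, inv_mul_cancel, map_one, Matrix.mul_one]
  have hsymm (B : Matrix n n ℝ) (hB : ∀ g, (M g)ᵀ * B * M g = B) : Bᵀ = B := by
    obtain ⟨c, hc⟩ := hscalar (h⁻¹ * B) fun g ↦ by
      change h⁻¹ * B * M g = M g * (h⁻¹ * B)
      have hMg : h * (M g * (h⁻¹ * B)) = B * M g := by
        rw [← Matrix.mul_assoc, hcomm h hhinv, Matrix.mul_assoc,
          Matrix.mul_nonsing_inv_cancel_left _ _ hdet, hcomm B hB]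
      rw [Matrix.mul_assoc, ← hMg, Matrix.nonsing_inv_mul_cancel_left _ _ hdet]
    have : B = c • h := by
      rw [← Matrix.mul_nonsing_inv_cancel_left h B hdet, hc]; simp
    rw [this, Matrix.transpose_smul, hhT]
  let T (g : G) : Matrix n n ℝ →ₗ[ℝ] Matrix n n ℝ :=
    { toFun := fun B ↦ (M g)ᵀ * Bᵀ * M g
      map_add' := by simp [Matrix.mul_add, Matrix.add_mul]
      map_smul' := by simp }
  let S : Matrix n n ℝ →ₗ[ℝ] Matrix n n ℝ := (Fintype.card G : ℝ)⁻¹ • ∑ g, T g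
  have hcard : (Fintype.card G : ℝ) ≠ 0 := by simp
  have hS (B : Matrix n n ℝ) : S B = (Fintype.card G : ℝ)⁻¹ • ∑ g, (M g)ᵀ * Bᵀ * M g := by
    simp [S, T]
  have hSinv (B : Matrix n n ℝ) (g : G) : (M g)ᵀ * S B * M g = S B := by
    rw [hS, Matrix.mul_smul, Matrix.smul_mul, hinv]
  have hSid : IsIdempotentElem S := by
    refine LinearMap.ext fun B ↦ ?_
    rw [Module.End.mul_apply, hS (S B), hsymm _ (hSinv B)]
    simp only [hSinv]
    rw [Finset.sum_const, Finset.card_univ, ← Nat.cast_smul_eq_nsmul ℝ, smul_smul,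
      inv_mul_cancel₀ hcard, one_smul]
  have htrace : LinearMap.trace ℝ _ S = 0 := by
    have hsum : ∑ g, M g * M g = 0 := by
      rw [← hM]
      refine Fintype.sum_equiv (powCoprime (Nat.coprime_two_right.2 hodd)) _ _ fun g ↦ ?_
      simp [pow_two]
    simp only [S, map_smul, map_sum,
      fun g ↦ Matrix.trace_transpose_congruence (M g) (T g) fun _ ↦ rfl]
    rw [← Matrix.trace_sum, hsum, Matrix.trace_zero, smul_zero]
  have hSh : S 1 = 0 := by
    rw [LinearMap.IsIdempotentElem.eq_zero_of_trace_eq_zero hSid htrace, LinearMap.zero_apply]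
  have hh0 : h = 0 := by
    rw [hS] at hSh
    simpa [hcard] using hSh
  simp [hh0] at hdet

namespace Representation

variable {G : Type*} [Group G]

instance {k V : Type*} [CommRing k] [AddCommGroup V] [Module k V] (ρ : Representation k G V) :
    Ring (IntertwiningMap ρ ρ) :=
  { (inferInstance : Semiring (IntertwiningMap ρ ρ)),
    (inferInstance : AddCommGroup (IntertwiningMap ρ ρ)) with }

/-- The operators of a representation of a finite group without nonzero invariant vectors sum to
zero. -/
theorem sum_apply_eq_zero_of_forall_invariant {k V : Type*} [CommRing k] [AddCommGroup V]
    [Module k V] [Fintype G] (ρ : Representation k G V)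
    (hρ : ∀ v, (∀ g, ρ g v = v) → v = 0) : ∑ g, ρ g = 0 := by
  refine LinearMap.ext fun v ↦ hρ _ fun g ↦ ?_
  simp only [LinearMap.sum_apply, map_sum, ← Module.End.mul_apply, ← map_mul]
  exact Fintype.sum_equiv (Equiv.mulLeft g) _ _ fun _ ↦ rfl

/-- A nonzero real representation of a finite group of odd order without nonzero invariant vectors
has a non-scalar equivariant endomorphism. -/
theorem exists_intertwiningMap_notMem_range_of_odd_card [Finite G]
    (hodd : Odd (Nat.card G)) {V : Type*} [AddCommGroup V] [Module ℝ V] [FiniteDimensional ℝ V]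
    [Nontrivial V] (ρ : Representation ℝ G V) (hρ : ∀ v, (∀ g, ρ g v = v) → v = 0) :
    ∃ f : IntertwiningMap ρ ρ, f ∉ (algebraMap ℝ (IntertwiningMap ρ ρ)).range := by
  have := Fintype.ofFinite G
  let e := LinearMap.toMatrixAlgEquiv (Module.finBasis ℝ V)
  have : Nonempty (Fin (Module.finrank ℝ V)) := ⟨⟨0, Module.finrank_pos⟩⟩
  have hsum : ∑ g, e (ρ g) = 0 := by
    rw [← map_sum, ρ.sum_apply_eq_zero_of_forall_invariant hρ, map_zero]
  obtain ⟨A, hA, hA'⟩ :=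
    Matrix.exists_commute_not_scalar_of_odd_card hodd (e.toMulEquiv.toMonoidHom.comp ρ) hsum
  refine ⟨⟨e.symm A, fun g ↦ e.injective ?_⟩, ?_⟩
  · simpa [← Module.End.mul_eq_comp] using! (hA g).eq
  · rintro ⟨c, hc⟩
    apply hA' c
    have hlin : c • (1 : Module.End ℝ V) = e.symm A := congrArg IntertwiningMap.toLinearMap hc
    rw [← e.apply_symm_apply A, ← hlin, map_smul, map_one]

/-- A real irreducible representation of a finite group of odd order without nonzero invariant
vectors has an invariant complex structure. -/
theorem IsIrreducible.exists_mul_self_eq_neg_one_of_odd_card [Finite G]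
    (hodd : Odd (Nat.card G)) {V : Type*} [AddCommGroup V] [Module ℝ V] [FiniteDimensional ℝ V]
    [Nontrivial V] (ρ : Representation ℝ G V) [ρ.IsIrreducible]
    (hρ : ∀ v, (∀ g, ρ g v = v) → v = 0) :
    ∃ J : IntertwiningMap ρ ρ, J * J = -1 := by
  have : Nontrivial (IntertwiningMap ρ ρ) := by
    obtain ⟨v, hv⟩ := exists_ne (0 : V)
    exact ⟨1, 0, fun h ↦ hv (congrArg (fun f : IntertwiningMap ρ ρ ↦ f v) h)⟩
  have : NoZeroDivisors (IntertwiningMap ρ ρ) := ⟨fun {a b} hab ↦ by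
    refine (injective_or_eq_zero a).symm.imp_right fun ha ↦ ?_
    refine IntertwiningMap.ext (LinearMap.ext fun v ↦ ha ?_)
    exact (congrArg (fun f : IntertwiningMap ρ ρ ↦ f v) hab).trans (map_zero a).symm⟩
  have : IsDomain (IntertwiningMap ρ ρ) := NoZeroDivisors.to_isDomain _
  obtain ⟨f, hf⟩ := ρ.exists_intertwiningMap_notMem_range_of_odd_card hodd hρ
  exact exists_mul_self_eq_neg_one_of_isIntegral (Algebra.IsIntegral.isIntegral f) hf

/-- Invariant complex structures on two complementary subrepresentations combine to one on the
whole representation. -/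
theorem exists_mul_self_eq_neg_one_of_isCompl {V : Type*} [AddCommGroup V] [Module ℝ V]
    {ρ : Representation ℝ G V} {σ τ : Subrepresentation ρ} (h : IsCompl σ τ)
    (hσ : ∃ J : IntertwiningMap σ.toRepresentation σ.toRepresentation, J * J = -1)
    (hτ : ∃ J : IntertwiningMap τ.toRepresentation τ.toRepresentation, J * J = -1) :
    ∃ J : IntertwiningMap ρ ρ, J * J = -1 := by
  obtain ⟨J, hJ⟩ := hσ
  obtain ⟨K, hK⟩ := hτ
  have hc : IsCompl σ.toSubmodule τ.toSubmodule := by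
    refine IsCompl.of_eq ?_ ?_
    · exact congrArg Subrepresentation.toSubmodule h.inf_eq_bot
    · exact congrArg Subrepresentation.toSubmodule h.sup_eq_top
  let L : V →ₗ[ℝ] V := LinearMap.ofIsCompl hc (σ.toSubmodule.subtype ∘ₗ J.toLinearMap)
    (τ.toSubmodule.subtype ∘ₗ K.toLinearMap)
  have hLσ (v : σ.toSubmodule) : L v = J v := LinearMap.ofIsCompl_apply_left hc v
  have hLτ (v : τ.toSubmodule) : L v = K v := LinearMap.ofIsCompl_apply_right hc v
  have hext (v : V) : ∃ (a : σ.toSubmodule) (b : τ.toSubmodule), (a : V) + b = v := by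
    obtain ⟨a, b, hab, -⟩ := Submodule.existsUnique_add_of_isCompl hc v
    exact ⟨a, b, hab⟩
  refine ⟨⟨L, fun g ↦ LinearMap.ext fun v ↦ ?_⟩, IntertwiningMap.ext (LinearMap.ext fun v ↦ ?_)⟩
  · obtain ⟨a, b, rfl⟩ := hext v
    have ha : L (ρ g a) = ρ g (J a) :=
      (hLσ (σ.toRepresentation g a)).trans (congrArg Subtype.val (J.isIntertwining _ _ g a))
    have hb : L (ρ g b) = ρ g (K b) :=
      (hLτ (τ.toRepresentation g b)).trans (congrArg Subtype.val (K.isIntertwining _ _ g b))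
    simp only [LinearMap.comp_apply, map_add, hLσ, hLτ, ha, hb]
  · obtain ⟨a, b, rfl⟩ := hext v
    have ha : ((J (J a) : σ.toSubmodule) : V) = -a :=
      congrArg Subtype.val (DFunLike.congr_fun hJ a)
    have hb : ((K (K b) : τ.toSubmodule) : V) = -b :=
      congrArg Subtype.val (DFunLike.congr_fun hK b)
    change L (L (a + b)) = -(a + b)
    rw [map_add, map_add, hLσ, hLτ, hLσ, hLτ, ha, hb, neg_add]

/-- A finite-dimensional real representation of a finite group of odd order without nonzero
invariant vectors has an invariant complex structure. -/
theorem exists_mul_self_eq_neg_one_of_odd_card [Finite G]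
    (hodd : Odd (Nat.card G)) {V : Type*} [AddCommGroup V] [Module ℝ V] [FiniteDimensional ℝ V]
    (ρ : Representation ℝ G V) (hρ : ∀ v, (∀ g, ρ g v = v) → v = 0) :
    ∃ J : IntertwiningMap ρ ρ, J * J = -1 := by
  induction hn : Module.finrank ℝ V using Nat.strong_induction_on generalizing V with
  | _ n ih =>
    subst hn
    rcases subsingleton_or_nontrivial V with hV | hV
    · exact ⟨0, IntertwiningMap.ext (LinearMap.ext fun v ↦ Subsingleton.elim _ _)⟩
    by_cases hirr : ρ.IsIrreducible
    · exact IsIrreducible.exists_mul_self_eq_neg_one_of_odd_card hodd ρ hρ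
    have hsub (σ : Subrepresentation ρ) (hσ : σ ≠ ⊤) :
        ∃ J : IntertwiningMap σ.toRepresentation σ.toRepresentation, J * J = -1 := by
      refine ih _ (Submodule.finrank_lt fun h ↦ hσ (Subrepresentation.toSubmodule_injective h)) _
        (fun v hv ↦ Subtype.ext (hρ v fun g ↦ congrArg Subtype.val (hv g))) rfl
    have hnt : Nontrivial (Subrepresentation ρ) := by
      refine ⟨⊥, ⊤, fun h ↦ bot_ne_top (α := Submodule ℝ V) ?_⟩
      exact congrArg Subrepresentation.toSubmodule h
    obtain ⟨σ, hbot, htop⟩ : ∃ σ : Subrepresentation ρ, σ ≠ ⊥ ∧ σ ≠ ⊤ := by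
      by_contra! h
      exact hirr ⟨fun σ ↦ or_iff_not_imp_left.2 (h σ)⟩
    obtain ⟨τ, hτ⟩ := exists_isCompl σ
    refine exists_mul_self_eq_neg_one_of_isCompl hτ (hsub σ htop) (hsub τ fun h ↦ hbot ?_)
    simpa [h] using hτ.inf_eq_bot

end Representation

/-- If `G` is a finite group of odd order, then every finite-dimensional real representation
of `G` with no nonzero invariant vectors admits a `G`-invariant complex structure. -/
theorem stmt_4 {G : Type*} [Group G] [Finite G] (hodd : Odd (Nat.card G))
    (R : Type*) [AddCommGroup R] [Module ℝ R] [FiniteDimensional ℝ R]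
    (ρ : Representation ℝ G R)
    (hR : ∀ v : R, (∀ g : G, ρ g v = v) → v = 0) :
    ∃ J : R →ₗ[ℝ] R, (∀ v : R, J (J v) = -v) ∧
      ∀ (g : G) (v : R), J (ρ g v) = ρ g (J v) := by
  obtain ⟨J, hJ⟩ := ρ.exists_mul_self_eq_neg_one_of_odd_card hodd hR
  exact ⟨J.toLinearMap, fun v ↦ DFunLike.congr_fun hJ v, J.isIntertwining⟩
end

section
/- Let E be a group and let N be a subgroup of E contained in the center of E. Suppose that the quotient group E/N is cyclic of finite order n, and that every element of N has an n-th root in N (i.e. for every x ∈ N there exists y ∈ N with yⁿ = x). Then the quotient homomorphism π : E → E/N splits: there exists a group homomorphism s : E/N → E with π ∘ s = id. Consequently E is isomorphic to the direct product N × (E/N). -/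
/-- A homomorphism with a right inverse whose kernel is contained in the center exhibits its
domain as the product of its kernel and its codomain. -/
theorem MonoidHom.nonempty_mulEquiv_ker_prod_of_comp_eq_id {E Q : Type*} [Group E] [Group Q]
    (f : E →* Q) (hf : f.ker ≤ Subgroup.center E) (s : Q →* E)
    (hs : f.comp s = MonoidHom.id Q) : Nonempty (E ≃* f.ker × Q) := by
  have hfs (q : Q) : f (s q) = q := DFunLike.congr_fun hs q
  have hcomm (x : f.ker) (q : Q) : Commute (f.ker.subtype x) (s q) :=
    (Subgroup.mem_center_iff.mp (hf x.2) (s q)).symm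
  refine ⟨(MulEquiv.ofBijective (f.ker.subtype.noncommCoprod s hcomm) ⟨?_, fun e => ?_⟩).symm⟩
  · refine (injective_iff_map_eq_one _).mpr ?_
    rintro ⟨x, q⟩ h
    have h : (x : E) * s q = 1 := h
    have hq : q = 1 := by simpa [hfs, MonoidHom.mem_ker.mp x.2] using congrArg f h
    subst hq
    simpa using h
  · exact ⟨(⟨e * (s (f e))⁻¹, by simp [MonoidHom.mem_ker, hfs]⟩, f e), by simp⟩

/-- A homomorphism onto a cyclic group has a right inverse as soon as a generator of the
codomain lifts to an element whose order divides that of the generator. -/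
theorem MonoidHom.exists_comp_eq_id_of_pow_orderOf_eq_one {E Q : Type*} [Group E] [Group Q]
    (f : E →* Q) {g : Q} (hg : ∀ q, q ∈ Subgroup.zpowers g) {e : E} (he : f e = g)
    (hpow : e ^ orderOf g = 1) : ∃ s : Q →* E, f.comp s = MonoidHom.id Q := by
  refine ⟨monoidHomOfForallMemZpowers hg (orderOf_dvd_of_pow_eq_one hpow), ?_⟩
  refine MonoidHom.ext fun q => ?_
  obtain ⟨k, rfl⟩ := Subgroup.mem_zpowers_iff.mp (hg q)
  simp [map_zpow, monoidHomOfForallMemZpowers_apply_gen, he]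

/-- Let `N` be a central subgroup of a group `E` such that `E/N` is cyclic of finite order `n`
and every element of `N` has an `n`-th root in `N`. Then the quotient map `E → E/N` splits,
and consequently `E ≅ N × (E/N)`. -/
theorem stmt_7 {E : Type*} [Group E] (N : Subgroup E) [N.Normal]
    (hN : N ≤ Subgroup.center E) (n : ℕ) (hn : 0 < n)
    (hcyc : IsCyclic (E ⧸ N)) (hcard : Nat.card (E ⧸ N) = n)
    (hroot : ∀ x ∈ N, ∃ y ∈ N, y ^ n = x) :
    (∃ s : (E ⧸ N) →* E, (QuotientGroup.mk' N).comp s = MonoidHom.id (E ⧸ N)) ∧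
      Nonempty (E ≃* N × (E ⧸ N)) := by
  obtain ⟨s, hs⟩ : ∃ s : (E ⧸ N) →* E,
      (QuotientGroup.mk' N).comp s = MonoidHom.id (E ⧸ N) := by
    obtain ⟨g, hg⟩ := hcyc.exists_generator
    obtain ⟨e, rfl⟩ := QuotientGroup.mk'_surjective N g
    have hord : orderOf (QuotientGroup.mk' N e) = n :=
      (orderOf_eq_card_of_forall_mem_zpowers hg).trans hcard
    have hen : e ^ n ∈ N := by
      rw [← QuotientGroup.eq_one_iff, QuotientGroup.mk_pow, ← hord]
      exact pow_orderOf_eq_one _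
    obtain ⟨y, hy, hyn⟩ := hroot _ hen
    have hcomm : Commute e y⁻¹ := Subgroup.mem_center_iff.mp (hN (N.inv_mem hy)) e
    refine MonoidHom.exists_comp_eq_id_of_pow_orderOf_eq_one _ hg (e := e * y⁻¹) ?_ ?_
    · have hy1 : QuotientGroup.mk' N y = 1 := (QuotientGroup.eq_one_iff y).mpr hy
      rw [map_mul, map_inv, hy1, inv_one, mul_one]
    · rw [hord, hcomm.mul_pow, inv_pow, hyn, mul_inv_cancel]
  refine ⟨⟨s, hs⟩, ?_⟩
  have hker := QuotientGroup.ker_mk' N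
  obtain ⟨φ⟩ := MonoidHom.nonempty_mulEquiv_ker_prod_of_comp_eq_id _ (hker.trans_le hN) s hs
  exact ⟨φ.trans ((MulEquiv.subgroupCongr hker).prodCongr (MulEquiv.refl _))⟩
end

section
/- Let p be a prime, k ≥ 1 a natural number, and n = p^k. Let j ∈ ℤ/nℤ and let a : ℤ/nℤ → ℕ be any function. In the polynomial ring (ℤ/nℤ)[X, V] in two variables, set e = ∏_{u ∈ ℤ/nℤ, u ≡ j (mod p)} (X + u·V)^{a(u)}, where u ≡ j (mod p) means that u and j have the same image under the reduction map ℤ/nℤ → ℤ/pℤ. Let B = (ℤ/nℤ)[X, V]/(e) and let B_v denote the localization of B away from the image of V (i.e. inverting the powers of the image of V). Then for every u′ ∈ ℤ/nℤ with u′ ≢ j (mod p), the image of X + u′·V in B_v is a unit. -/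
/-- An element of `ℤ/p^k` that does not vanish modulo `p` is a unit. -/
theorem ZMod.isUnit_of_castHom_ne_zero {p k n : ℕ} (hp : p.Prime) (hn : n = p ^ k) [NeZero n]
    (hpn : p ∣ n) {w : ZMod n} (hw : ZMod.castHom hpn (ZMod p) w ≠ 0) : IsUnit w := by
  rw [← ZMod.natCast_zmod_val w] at hw ⊢
  rw [map_natCast, Ne, ZMod.natCast_eq_zero_iff] at hw
  rw [ZMod.isUnit_iff_coprime]
  have h := ((Nat.Prime.coprime_iff_not_dvd hp).2 hw).symm.pow_right k
  rwa [← hn] at h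

/-- Two elements whose difference is a unit are coprime. -/
theorem IsCoprime.of_isUnit_sub {R : Type*} [CommRing R] {x y : R} (h : IsUnit (x - y)) :
    IsCoprime x y := by
  obtain ⟨b, hb⟩ := h.exists_left_inv
  exact ⟨b, -b, by linear_combination hb⟩

/-- Let `n = p^k` be a prime power, `j ∈ ℤ/n` and `a : ℤ/n → ℕ`.  In `(ℤ/n)[X, V]` set
`e = ∏_{u ≡ j mod p} (X + u·V)^(a u)`.  Then in the localization of `(ℤ/n)[X, V]/(e)` away
from (the image of) `V`, the image of `X + u'·V` is a unit for every `u' ≢ j mod p`. -/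
theorem stmt_9 {p k n : ℕ} (hp : p.Prime) (hk : 1 ≤ k) (hn : n = p ^ k) [NeZero n]
    (hpn : p ∣ n) (j : ZMod n) (a : ZMod n → ℕ)
    (e : MvPolynomial (Fin 2) (ZMod n))
    (he : e = ∏ u ∈ Finset.univ.filter
        (fun u : ZMod n =>
          ZMod.castHom hpn (ZMod p) u = ZMod.castHom hpn (ZMod p) j),
      (MvPolynomial.X 0 + MvPolynomial.C u * MvPolynomial.X 1) ^ a u)
    (u' : ZMod n)
    (hu' : ZMod.castHom hpn (ZMod p) u' ≠ ZMod.castHom hpn (ZMod p) j) :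
    IsUnit (algebraMap (MvPolynomial (Fin 2) (ZMod n) ⧸ Ideal.span {e})
      (Localization.Away
        ((Ideal.Quotient.mk (Ideal.span {e})) (MvPolynomial.X 1)))
      ((Ideal.Quotient.mk (Ideal.span {e}))
        (MvPolynomial.X 0 + MvPolynomial.C u' * MvPolynomial.X 1))) := by
  set v := (Ideal.Quotient.mk (Ideal.span {e})) (MvPolynomial.X 1)
  set φ := (algebraMap (MvPolynomial (Fin 2) (ZMod n) ⧸ Ideal.span {e})
    (Localization.Away v)).comp (Ideal.Quotient.mk (Ideal.span {e})) with hφ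
  have hv : IsUnit (φ (MvPolynomial.X 1)) := IsLocalization.Away.algebraMap_isUnit v
  have he0 : φ e = 0 := by
    rw [hφ, RingHom.comp_apply,
      Ideal.Quotient.eq_zero_iff_mem.2 (Ideal.mem_span_singleton_self e), map_zero]
  replace he0 := (congrArg φ he).symm.trans he0
  rw [map_prod] at he0
  change IsUnit (φ (MvPolynomial.X 0 + MvPolynomial.C u' * MvPolynomial.X 1))
  rw [← isCoprime_zero_left, ← he0]
  refine IsCoprime.prod_left fun u hu => ?_
  rw [map_pow]
  refine IsCoprime.pow_left (IsCoprime.of_isUnit_sub ?_)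
  have huu : IsUnit (u - u') := by
    refine ZMod.isUnit_of_castHom_ne_zero hp hn hpn ?_
    rw [map_sub, (Finset.mem_filter.1 hu).2]
    exact sub_ne_zero.2 hu'.symm
  rw [← map_sub, add_sub_add_left_eq_sub, ← sub_mul, ← MvPolynomial.C_sub, map_mul]
  exact ((huu.map MvPolynomial.C).map φ).mul hv
end

section
/- Let p be a prime, k ≥ 1 a natural number, and n = p^k. Let S be a finite set, let a : S → ℕ, let c : S → ℤ/nℤ, and set e = ∏_{u ∈ S} (Y + p·c(u)·V)^{a(u)} in the polynomial ring (ℤ/nℤ)[Y, V] in two variables. Then the image of Y in the quotient ring (ℤ/nℤ)[Y, V]/(e) is nilpotent; more precisely, Y^{k·r} lies in the ideal (e), where r = Σ_{u ∈ S} a(u). -/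
theorem dvd_pow_of_dvd_sub {R : Type*} [CommRing R] {d x e : R} {k : ℕ}
    (hd : d ^ k = 0) (h : d ∣ x - e) : e ∣ x ^ k := by
  have hzero : (x - e) ^ k = 0 := zero_dvd_iff.mp (hd ▸ pow_dvd_pow_of_dvd h k)
  simpa [hzero] using sub_dvd_pow_sub_pow x (x - e) k

theorem dvd_pow_sum_sub_prod {R ι : Type*} [CommRing R] (s : Finset ι) (a : ι → ℕ)
    (d y : R) (b : ι → R) :
    d ∣ y ^ (∑ u ∈ s, a u) - ∏ u ∈ s, (y + d * b u) ^ a u := by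
  have hd : Ideal.Quotient.mk (Ideal.span {d}) d = 0 :=
    Ideal.Quotient.eq_zero_iff_mem.mpr (Ideal.mem_span_singleton_self d)
  rw [← Ideal.mem_span_singleton, ← Ideal.Quotient.eq_zero_iff_mem]
  simp [map_prod, hd, Finset.prod_pow_eq_pow_sum]

/-- Let `n = p^k` be a prime power (`k ≥ 1`), `S` a finite set, `a : S → ℕ`,
`c : S → ℤ/n`, and `e = ∏_{u ∈ S} (Y + p·c(u)·V)^(a u)` in `(ℤ/n)[Y, V]` (with `Y` and `V`
the two variables).  Then the image of `Y` in `(ℤ/n)[Y, V]/(e)` is nilpotent; more precisely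
`Y^(k·r) ∈ (e)` where `r = ∑_{u ∈ S} a u`. -/
theorem stmt_10 {p k n : ℕ} (hp : p.Prime) (hk : 1 ≤ k) (hn : n = p ^ k)
    (S : Type*) [Fintype S] (a : S → ℕ) (c : S → ZMod n)
    (e : MvPolynomial (Fin 2) (ZMod n))
    (he : e = ∏ u : S,
      (MvPolynomial.X 0 + MvPolynomial.C ((p : ZMod n) * c u) * MvPolynomial.X 1) ^ a u) :
    IsNilpotent ((Ideal.Quotient.mk (Ideal.span {e})) (MvPolynomial.X 0)) ∧
      (MvPolynomial.X 0 : MvPolynomial (Fin 2) (ZMod n)) ^ (k * ∑ u : S, a u) ∈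
        Ideal.span {e} := by
  have hmem : (MvPolynomial.X 0 : MvPolynomial (Fin 2) (ZMod n)) ^ (k * ∑ u : S, a u) ∈
      Ideal.span {e} := by
    rw [Ideal.mem_span_singleton, mul_comm, pow_mul]
    refine dvd_pow_of_dvd_sub (d := MvPolynomial.C (p : ZMod n)) ?_ ?_
    · rw [← map_pow, ← Nat.cast_pow, ← hn, ZMod.natCast_self, map_zero]
    · simpa only [he, map_mul, mul_assoc] using
        dvd_pow_sum_sub_prod Finset.univ a (MvPolynomial.C (p : ZMod n)) (MvPolynomial.X 0)
          fun u ↦ MvPolynomial.C (c u) * MvPolynomial.X (1 : Fin 2)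
  refine ⟨⟨k * ∑ u : S, a u, ?_⟩, hmem⟩
  rw [← map_pow]
  exact Ideal.Quotient.eq_zero_iff_mem.mpr hmem
end
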